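/- Over a field of characteristic 2, let pe^{(i)}(k) denote the derived superalgebras of the periplectic Lie superalgebra pe(k). Then: pe^{(1)}(k) consists of matrices [[A,C],[D,Aᵀ]] with A ∈ gl(k) and C, D symmetric with zero diagonal; pe^{(2)}(k) additionally requires tr(A) = 0. The map F((X,X')) = ∑_{i<j}(C_{ij}D'_{ij} + C'_{ij}D_{ij}), for X = [[A,C],[D,Aᵀ]] and X' = [[A',C'],[D',A'ᵀ]], is a 2-cocycle on pe^{(1)}(k) defining a nontrivial central extension. -/

import Mathlib

open Matrix

variable (K : Type*) [Field K] (k : ℕ)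

/-- The periplectic Lie superalgebra `pe(k)` in characteristic 2:
matrices `[[A,C],[D,Aᵀ]]` with `C`, `D` symmetric. -/
def peSet : Set (Matrix (Fin k ⊕ Fin k) (Fin k ⊕ Fin k) K) :=
  {X | ∃ A C D : Matrix (Fin k) (Fin k) K,
    Cᵀ = C ∧ Dᵀ = D ∧ X = Matrix.fromBlocks A C D Aᵀ}

/-- The claimed first derived superalgebra `pe^{(1)}(k)`: `C`, `D` symmetric with zero
diagonal. -/
def peSet1 : Set (Matrix (Fin k ⊕ Fin k) (Fin k ⊕ Fin k) K) :=
  {X | ∃ A C D : Matrix (Fin k) (Fin k) K,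
    Cᵀ = C ∧ Dᵀ = D ∧ (∀ i, C i i = 0) ∧ (∀ i, D i i = 0) ∧
    X = Matrix.fromBlocks A C D Aᵀ}

/-- The claimed second derived superalgebra `pe^{(2)}(k)`: additionally `tr A = 0`. -/
def peSet2 : Set (Matrix (Fin k ⊕ Fin k) (Fin k ⊕ Fin k) K) :=
  {X | ∃ A C D : Matrix (Fin k) (Fin k) K,
    Cᵀ = C ∧ Dᵀ = D ∧ (∀ i, C i i = 0) ∧ (∀ i, D i i = 0) ∧ A.trace = 0 ∧
    X = Matrix.fromBlocks A C D Aᵀ}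

/-- An element is odd if its diagonal blocks vanish. -/
def isOddMat (X : Matrix (Fin k ⊕ Fin k) (Fin k ⊕ Fin k) K) : Prop :=
  X.toBlocks₁₁ = 0 ∧ X.toBlocks₂₂ = 0

/-- The derived superalgebra of a set `S` of matrices in characteristic 2: the span of
all brackets `[X,Y] = XY + YX` of elements of `S` together with all squares `X²` of odd
elements of `S`. -/
def derivedSpan (S : Set (Matrix (Fin k ⊕ Fin k) (Fin k ⊕ Fin k) K)) :
    Submodule K (Matrix (Fin k ⊕ Fin k) (Fin k ⊕ Fin k) K) :=
  Submodule.span K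
    ({Z | ∃ X ∈ S, ∃ Y ∈ S, Z = X * Y + Y * X} ∪
     {Z | ∃ X ∈ S, isOddMat K k X ∧ Z = X * X})

/-- The cocycle `F(X,X') = ∑_{i<j} (C_{ij} D'_{ij} + C'_{ij} D_{ij})` on `pe^{(1)}(k)`,
where `C` is the upper-right and `D` the lower-left block. -/
def peCocycle (X Y : Matrix (Fin k ⊕ Fin k) (Fin k ⊕ Fin k) K) : K :=
  ∑ q ∈ Finset.univ.filter (fun q : Fin k × Fin k => q.1 < q.2),
    (X.toBlocks₁₂ q.1 q.2 * Y.toBlocks₂₁ q.1 q.2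
      + Y.toBlocks₁₂ q.1 q.2 * X.toBlocks₂₁ q.1 q.2)

section Periplectic

variable {K : Type*} [Field K] {k : ℕ}

/-- The supercommutator of two elements of `pe(k)`, in block form. -/
theorem pe_bracket (A C D A' C' D' : Matrix (Fin k) (Fin k) K)
    (hC : Cᵀ = C) (hD : Dᵀ = D) (hC' : C'ᵀ = C') (hD' : D'ᵀ = D') :
    fromBlocks A C D Aᵀ * fromBlocks A' C' D' A'ᵀ + fromBlocks A' C' D' A'ᵀ * fromBlocks A C D Aᵀ =
      fromBlocks (A * A' + A' * A + (C * D' + C' * D))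
        ((A * C' + A' * C) + (A * C' + A' * C)ᵀ)
        ((D * A' + D' * A) + (D * A' + D' * A)ᵀ)
        (A * A' + A' * A + (C * D' + C' * D))ᵀ := by
  simp only [fromBlocks_multiply, fromBlocks_add, transpose_add, transpose_mul, hC, hD, hC', hD']
  congr 1 <;> abel

theorem exists_eq_add_transpose {C : Matrix (Fin k) (Fin k) K} (hC : Cᵀ = C)
    (hC0 : ∀ i, C i i = 0) : ∃ U : Matrix (Fin k) (Fin k) K, C = U + Uᵀ := by
  refine ⟨Matrix.of fun i j => if i < j then C i j else 0, ?_⟩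
  ext i j
  have hs : C j i = C i j := congrFun (congrFun hC i) j
  rcases lt_trichotomy i j with h | rfl | h
  · simp [h, h.not_gt]
  · simp [hC0]
  · simp [h, h.not_gt, hs]

theorem add_transpose_diag [CharP K 2] (B : Matrix (Fin k) (Fin k) K) (i : Fin k) :
    (B + Bᵀ) i i = 0 := by
  simp [CharTwo.add_self_eq_zero]

theorem transpose_add_transpose (B : Matrix (Fin k) (Fin k) K) : (B + Bᵀ)ᵀ = B + Bᵀ := by
  rw [transpose_add, transpose_transpose, add_comm]

theorem trace_mul_eq_zero_of_alternating [CharP K 2] {C D : Matrix (Fin k) (Fin k) K}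
    (hC : Cᵀ = C) (hC0 : ∀ i, C i i = 0) (hD : Dᵀ = D) : (C * D).trace = 0 := by
  obtain ⟨U, rfl⟩ := exists_eq_add_transpose hC hC0
  have h : (Uᵀ * D).trace = (U * D).trace := by
    rw [← trace_transpose, transpose_mul, transpose_transpose, hD, trace_mul_comm]
  rw [add_mul, trace_add, h, CharTwo.add_self_eq_zero]

theorem sum_lt_add_transpose_mul (B : Matrix (Fin k) (Fin k) K) {D : Matrix (Fin k) (Fin k) K}
    (hD : Dᵀ = D) (hD0 : ∀ i, D i i = 0) :
    ∑ q ∈ Finset.univ.filter (fun q : Fin k × Fin k => q.1 < q.2),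
      (B + Bᵀ) q.1 q.2 * D q.1 q.2 = (B * D).trace := by
  have hs (i j : Fin k) : D j i = D i j := congrFun (congrFun hD i) j
  have hswap : ∑ q : Fin k × Fin k, (if q.1 < q.2 then B q.2 q.1 * D q.1 q.2 else 0) =
      ∑ q : Fin k × Fin k, if q.2 < q.1 then B q.1 q.2 * D q.2 q.1 else 0 :=
    (Equiv.prodComm (Fin k) (Fin k)).sum_comp
      fun q : Fin k × Fin k => if q.2 < q.1 then B q.1 q.2 * D q.2 q.1 else 0
  have htr : (B * D).trace = ∑ q : Fin k × Fin k, B q.1 q.2 * D q.2 q.1 := by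
    simp [Matrix.trace, Matrix.mul_apply, Fintype.sum_prod_type]
  have hsplit (q : Fin k × Fin k) :
      (if q.1 < q.2 then (B + Bᵀ) q.1 q.2 * D q.1 q.2 else 0) =
        (if q.1 < q.2 then B q.1 q.2 * D q.1 q.2 else 0) +
          if q.1 < q.2 then B q.2 q.1 * D q.1 q.2 else 0 := by
    split_ifs <;> simp [add_mul]
  rw [Finset.sum_filter, Finset.sum_congr rfl fun q _ => hsplit q, Finset.sum_add_distrib, hswap,
    ← Finset.sum_add_distrib, htr]
  refine Finset.sum_congr rfl fun q _ => ?_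
  obtain ⟨i, j⟩ := q
  rcases lt_trichotomy i j with h | rfl | h
  · simp [h, h.not_gt, hs i j]
  · simp [hD0]
  · simp [h, h.not_gt]

variable (K k) in
/-- `peSet1` as a subspace. -/
def peSubmodule1 : Submodule K (Matrix (Fin k ⊕ Fin k) (Fin k ⊕ Fin k) K) where
  carrier := peSet1 K k
  zero_mem' := ⟨0, 0, 0, by simp, by simp, by simp, by simp, by simp⟩
  add_mem' := by
    rintro _ _ ⟨A, C, D, hC, hD, hC0, hD0, rfl⟩ ⟨A', C', D', hC', hD', hC0', hD0', rfl⟩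
    exact ⟨A + A', C + C', D + D', by simp [hC, hC'], by simp [hD, hD'], by simp [hC0, hC0'],
      by simp [hD0, hD0'], by simp [fromBlocks_add]⟩
  smul_mem' := by
    rintro c _ ⟨A, C, D, hC, hD, hC0, hD0, rfl⟩
    exact ⟨c • A, c • C, c • D, by simp [hC], by simp [hD], by simp [hC0], by simp [hD0],
      by simp [fromBlocks_smul]⟩

variable (K k) in
/-- `peSet2` as a subspace. -/
def peSubmodule2 : Submodule K (Matrix (Fin k ⊕ Fin k) (Fin k ⊕ Fin k) K) where
  carrier := peSet2 K k
  zero_mem' := ⟨0, 0, 0, by simp, by simp, by simp, by simp, by simp, by simp⟩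
  add_mem' := by
    rintro _ _ ⟨A, C, D, hC, hD, hC0, hD0, hA, rfl⟩ ⟨A', C', D', hC', hD', hC0', hD0', hA', rfl⟩
    exact ⟨A + A', C + C', D + D', by simp [hC, hC'], by simp [hD, hD'], by simp [hC0, hC0'],
      by simp [hD0, hD0'], by simp [hA, hA'], by simp [fromBlocks_add]⟩
  smul_mem' := by
    rintro c _ ⟨A, C, D, hC, hD, hC0, hD0, hA, rfl⟩
    exact ⟨c • A, c • C, c • D, by simp [hC], by simp [hD], by simp [hC0], by simp [hD0],
      by simp [hA], by simp [fromBlocks_smul]⟩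

theorem peSet1_subset_peSet : peSet1 K k ⊆ peSet K k := by
  rintro _ ⟨A, C, D, hC, hD, -, -, rfl⟩
  exact ⟨A, C, D, hC, hD, rfl⟩

theorem derivedSpan_mono {S T : Set (Matrix (Fin k ⊕ Fin k) (Fin k ⊕ Fin k) K)} (h : S ⊆ T) :
    derivedSpan K k S ≤ derivedSpan K k T := by
  refine Submodule.span_mono (Set.union_subset_union ?_ ?_)
  · rintro _ ⟨X, hX, Y, hY, rfl⟩
    exact ⟨X, h hX, Y, h hY, rfl⟩
  · rintro _ ⟨X, hX, hodd, rfl⟩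
    exact ⟨X, h hX, hodd, rfl⟩

theorem odd_mul_self {A C D : Matrix (Fin k) (Fin k) K} (hC : Cᵀ = C) (hD : Dᵀ = D)
    (hodd : isOddMat K k (fromBlocks A C D Aᵀ)) :
    fromBlocks A C D Aᵀ * fromBlocks A C D Aᵀ = fromBlocks (C * D) 0 0 (C * D)ᵀ := by
  obtain rfl : A = 0 := by simpa using hodd.1
  simp [fromBlocks_multiply, hC, hD]

theorem derivedSpan_peSet_le [CharP K 2] : derivedSpan K k (peSet K k) ≤ peSubmodule1 K k := by
  refine Submodule.span_le.2 (Set.union_subset ?_ ?_)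
  · rintro _ ⟨_, ⟨A, C, D, hC, hD, rfl⟩, _, ⟨A', C', D', hC', hD', rfl⟩, rfl⟩
    exact ⟨_, _, _, transpose_add_transpose _, transpose_add_transpose _, add_transpose_diag _,
      add_transpose_diag _, pe_bracket A C D A' C' D' hC hD hC' hD'⟩
  · rintro _ ⟨_, ⟨A, C, D, hC, hD, rfl⟩, hodd, rfl⟩
    exact ⟨C * D, 0, 0, by simp, by simp, by simp, by simp, odd_mul_self hC hD hodd⟩

theorem derivedSpan_peSet1_le [CharP K 2] : derivedSpan K k (peSet1 K k) ≤ peSubmodule2 K k := by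
  refine Submodule.span_le.2 (Set.union_subset ?_ ?_)
  · rintro _ ⟨_, ⟨A, C, D, hC, hD, hC0, hD0, rfl⟩, _, ⟨A', C', D', hC', hD', hC0', hD0', rfl⟩, rfl⟩
    refine ⟨_, _, _, transpose_add_transpose _, transpose_add_transpose _, add_transpose_diag _,
      add_transpose_diag _, ?_, pe_bracket A C D A' C' D' hC hD hC' hD'⟩
    rw [trace_add, trace_add, trace_add, trace_mul_comm A' A, CharTwo.add_self_eq_zero,
      trace_mul_eq_zero_of_alternating hC hC0 hD', trace_mul_eq_zero_of_alternating hC' hC0' hD]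
    simp
  · rintro _ ⟨_, ⟨A, C, D, hC, hD, hC0, hD0, rfl⟩, hodd, rfl⟩
    exact ⟨C * D, 0, 0, by simp, by simp, by simp, by simp,
      trace_mul_eq_zero_of_alternating hC hC0 hD, odd_mul_self hC hD hodd⟩

theorem bracket_mem_derivedSpan_peSet1 {A C D A' C' D' : Matrix (Fin k) (Fin k) K}
    (hC : Cᵀ = C) (hD : Dᵀ = D) (hC' : C'ᵀ = C') (hD' : D'ᵀ = D')
    (hC0 : ∀ i, C i i = 0) (hD0 : ∀ i, D i i = 0)
    (hC0' : ∀ i, C' i i = 0) (hD0' : ∀ i, D' i i = 0) :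
    fromBlocks (A * A' + A' * A + (C * D' + C' * D))
        ((A * C' + A' * C) + (A * C' + A' * C)ᵀ)
        ((D * A' + D' * A) + (D * A' + D' * A)ᵀ)
        (A * A' + A' * A + (C * D' + C' * D))ᵀ ∈ derivedSpan K k (peSet1 K k) :=
  Submodule.subset_span (Or.inl ⟨_, ⟨A, C, D, hC, hD, hC0, hD0, rfl⟩, _,
    ⟨A', C', D', hC', hD', hC0', hD0', rfl⟩, (pe_bracket A C D A' C' D' hC hD hC' hD').symm⟩)

theorem commutator_mem_derivedSpan_peSet1 (A A' : Matrix (Fin k) (Fin k) K) :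
    fromBlocks (A * A' + A' * A) 0 0 (A * A' + A' * A)ᵀ ∈ derivedSpan K k (peSet1 K k) := by
  simpa using bracket_mem_derivedSpan_peSet1 (A := A) (C := 0) (D := 0) (A' := A') (C' := 0)
    (D' := 0) (by simp) (by simp) (by simp) (by simp) (by simp) (by simp) (by simp) (by simp)

theorem upper_mem_derivedSpan_peSet1 [CharP K 2] (U : Matrix (Fin k) (Fin k) K) :
    fromBlocks 0 (U + Uᵀ) 0 0 ∈ derivedSpan K k (peSet1 K k) := by
  induction U using Matrix.induction_on' with
  | h_zero => simp
  | h_add U V hU hV =>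
    convert add_mem hU hV using 1
    rw [fromBlocks_add, transpose_add]
    simp only [add_zero]
    congr 1
    abel
  | h_std_basis i j a =>
    rcases eq_or_ne i j with rfl | hij
    · convert (derivedSpan K k (peSet1 K k)).zero_mem using 1
      simp [← single_add, CharTwo.add_self_eq_zero]
    · have h := bracket_mem_derivedSpan_peSet1 (A := single i i 1) (C := 0) (D := 0) (A' := 0)
        (C' := single i j a + (single i j a)ᵀ) (D' := 0) (by simp) (by simp)
        (transpose_add_transpose _) (by simp) (by simp) (by simp) (add_transpose_diag _) (by simp)
      simpa [mul_add, hij] using h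

theorem lower_mem_derivedSpan_peSet1 [CharP K 2] (U : Matrix (Fin k) (Fin k) K) :
    fromBlocks 0 0 (U + Uᵀ) 0 ∈ derivedSpan K k (peSet1 K k) := by
  induction U using Matrix.induction_on' with
  | h_zero => simp
  | h_add U V hU hV =>
    convert add_mem hU hV using 1
    rw [fromBlocks_add, transpose_add]
    simp only [add_zero]
    congr 1
    abel
  | h_std_basis i j a =>
    rcases eq_or_ne i j with rfl | hij
    · convert (derivedSpan K k (peSet1 K k)).zero_mem using 1
      simp [← single_add, CharTwo.add_self_eq_zero]
    · have h := bracket_mem_derivedSpan_peSet1 (A := single j j 1) (C := 0) (D := 0) (A' := 0)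
        (C' := 0) (D' := single i j a + (single i j a)ᵀ) (by simp) (by simp) (by simp)
        (transpose_add_transpose _) (by simp) (by simp) (by simp) (add_transpose_diag _)
      simpa [add_mul, hij] using h

theorem diag_mem_derivedSpan_peSet1 [CharP K 2] (i₀ : Fin k) (A : Matrix (Fin k) (Fin k) K) :
    fromBlocks (A + single i₀ i₀ A.trace) 0 0 (A + single i₀ i₀ A.trace)ᵀ
      ∈ derivedSpan K k (peSet1 K k) := by
  induction A using Matrix.induction_on' with
  | h_zero => simp
  | h_add A B hA hB =>
    convert add_mem hA hB using 1
    rw [fromBlocks_add, trace_add, single_add, ← transpose_add, add_add_add_comm]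
    simp only [add_zero]
  | h_std_basis i j a =>
    rcases eq_or_ne i j with rfl | hij
    · simpa using commutator_mem_derivedSpan_peSet1 (single i i₀ a) (single i₀ i 1)
    · simpa [hij, hij.symm, trace_single_eq_of_ne] using
        commutator_mem_derivedSpan_peSet1 (single i i 1) (single i j a)

theorem fromBlocks_mem_derivedSpan_peSet1 [CharP K 2] (i₀ : Fin k)
    {A C D : Matrix (Fin k) (Fin k) K} (hC : Cᵀ = C) (hD : Dᵀ = D) (hC0 : ∀ i, C i i = 0)
    (hD0 : ∀ i, D i i = 0) :
    fromBlocks (A + single i₀ i₀ A.trace) C D (A + single i₀ i₀ A.trace)ᵀ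
      ∈ derivedSpan K k (peSet1 K k) := by
  obtain ⟨U, rfl⟩ := exists_eq_add_transpose hC hC0
  obtain ⟨V, rfl⟩ := exists_eq_add_transpose hD hD0
  convert add_mem (add_mem (diag_mem_derivedSpan_peSet1 i₀ A) (upper_mem_derivedSpan_peSet1 U))
    (lower_mem_derivedSpan_peSet1 V) using 1
  simp only [fromBlocks_add, add_zero, zero_add]

theorem peSet2_subset_derivedSpan [CharP K 2] (i₀ : Fin k) :
    peSet2 K k ⊆ derivedSpan K k (peSet1 K k) := by
  rintro _ ⟨A, C, D, hC, hD, hC0, hD0, hA, rfl⟩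
  simpa [hA] using fromBlocks_mem_derivedSpan_peSet1 (A := A) i₀ hC hD hC0 hD0

theorem peSet1_subset_derivedSpan [CharP K 2] (i₀ : Fin k) :
    peSet1 K k ⊆ derivedSpan K k (peSet K k) := by
  rintro _ ⟨A, C, D, hC, hD, hC0, hD0, rfl⟩
  have hsq : fromBlocks (single i₀ i₀ (1 : K)) 0 0 (single i₀ i₀ 1) ∈
      derivedSpan K k (peSet K k) :=
    Submodule.subset_span (Or.inr ⟨fromBlocks 0 (single i₀ i₀ 1) (single i₀ i₀ 1) 0,
      ⟨0, single i₀ i₀ 1, single i₀ i₀ 1, by simp, by simp, by simp⟩, by simp [isOddMat],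
      by simp [fromBlocks_multiply]⟩)
  have h := add_mem (derivedSpan_mono peSet1_subset_peSet
    (fromBlocks_mem_derivedSpan_peSet1 (A := A) i₀ hC hD hC0 hD0))
    (Submodule.smul_mem _ A.trace hsq)
  have hz : single i₀ i₀ A.trace + single i₀ i₀ A.trace = 0 := by
    rw [← single_add, CharTwo.add_self_eq_zero, single_zero]
  simpa [fromBlocks_smul, fromBlocks_add, add_assoc, hz] using h

/-- The cocycle evaluated on a bracket, as a trace. -/
theorem peCocycle_bracket {A C D A' C' D' A'' C'' D'' : Matrix (Fin k) (Fin k) K}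
    (hC : Cᵀ = C) (hD : Dᵀ = D) (hC' : C'ᵀ = C') (hD' : D'ᵀ = D')
    (hC'' : C''ᵀ = C'') (hD'' : D''ᵀ = D'')
    (hC0'' : ∀ i, C'' i i = 0) (hD0'' : ∀ i, D'' i i = 0) :
    peCocycle K k (fromBlocks A C D Aᵀ * fromBlocks A' C' D' A'ᵀ +
        fromBlocks A' C' D' A'ᵀ * fromBlocks A C D Aᵀ) (fromBlocks A'' C'' D'' A''ᵀ) =
      (A * C' * D'').trace + (A' * C * D'').trace
        + ((A' * C'' * D).trace + (A * C'' * D').trace) := by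
  have hcyc (P Q R : Matrix (Fin k) (Fin k) K) : (P * Q * R).trace = (Q * R * P).trace := by
    rw [mul_assoc, trace_mul_comm]
  rw [pe_bracket A C D A' C' D' hC hD hC' hD', peCocycle, Finset.sum_add_distrib]
  simp only [toBlocks_fromBlocks₁₂, toBlocks_fromBlocks₂₁]
  rw [sum_lt_add_transpose_mul _ hD'' hD0'']
  simp_rw [mul_comm (C'' _ _)]
  rw [sum_lt_add_transpose_mul _ hC'' hC0'', add_mul, add_mul, trace_add, trace_add,
    hcyc D A' C'', hcyc D' A C'']

theorem peCocycle_cocycle [CharP K 2] {X Y Z : Matrix (Fin k ⊕ Fin k) (Fin k ⊕ Fin k) K}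
    (hX : X ∈ peSet1 K k) (hY : Y ∈ peSet1 K k) (hZ : Z ∈ peSet1 K k) :
    peCocycle K k (X * Y + Y * X) Z + peCocycle K k (Y * Z + Z * Y) X
      + peCocycle K k (Z * X + X * Z) Y = 0 := by
  obtain ⟨A, C, D, hC, hD, hC0, hD0, rfl⟩ := hX
  obtain ⟨A', C', D', hC', hD', hC0', hD0', rfl⟩ := hY
  obtain ⟨A'', C'', D'', hC'', hD'', hC0'', hD0'', rfl⟩ := hZ
  rw [peCocycle_bracket hC hD hC' hD' hC'' hD'' hC0'' hD0'',
    peCocycle_bracket hC' hD' hC'' hD'' hC hD hC0 hD0,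
    peCocycle_bracket hC'' hD'' hC hD hC' hD' hC0' hD0']
  have h2 : (2 : K) = 0 := CharTwo.two_eq_zero
  linear_combination ((A * C' * D'').trace + (A' * C * D'').trace + (A' * C'' * D).trace
    + (A * C'' * D').trace + (A'' * C' * D).trace + (A'' * C * D').trace) * h2

theorem peCocycle_not_coboundary [CharP K 2] {i j : Fin k} (hij : i < j) :
    ¬ ∃ g : Matrix (Fin k ⊕ Fin k) (Fin k ⊕ Fin k) K →ₗ[K] K,
        ∀ X ∈ peSet1 K k, ∀ Y ∈ peSet1 K k,
          peCocycle K k X Y = g (X * Y + Y * X) := by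
  rintro ⟨g, hg⟩
  have hne := hij.ne
  set S : Matrix (Fin k) (Fin k) K := single i j 1 + (single i j 1)ᵀ with hSdef
  have hS : Sᵀ = S := transpose_add_transpose _
  have hS0 : ∀ l, S l l = 0 := add_transpose_diag _
  have hSS : S * S = single i j 1 * single j i 1 + single j i 1 * single i j 1 := by
    simp [hSdef, mul_add, add_mul, hne, hne.symm, add_comm]
  have heven := hg (fromBlocks (single i j 1) 0 0 (single i j 1)ᵀ)
    ⟨_, 0, 0, by simp, by simp, by simp, by simp, rfl⟩
    (fromBlocks (single j i 1) 0 0 (single j i 1)ᵀ)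
    ⟨_, 0, 0, by simp, by simp, by simp, by simp, rfl⟩
  have hodd := hg (fromBlocks 0 S 0 (0)ᵀ) ⟨0, S, 0, hS, by simp, hS0, by simp, rfl⟩
    (fromBlocks 0 0 S (0)ᵀ) ⟨0, 0, S, by simp, hS, by simp, hS0, rfl⟩
  have hF : peCocycle K k (fromBlocks 0 S 0 (0)ᵀ) (fromBlocks 0 0 S (0)ᵀ) = 1 := by
    have h := sum_lt_add_transpose_mul (single i j 1) hS hS0
    rw [← hSdef] at h
    simp only [peCocycle, toBlocks_fromBlocks₁₂, toBlocks_fromBlocks₂₁, Matrix.zero_apply, mul_zero,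
      add_zero]
    rw [h]
    simp [hSdef, mul_add, hne.symm]
  have hF0 : peCocycle K k (fromBlocks (single i j 1) 0 0 (single i j 1)ᵀ)
      (fromBlocks (single j i 1) 0 0 (single j i 1)ᵀ) = 0 := by
    simp [peCocycle]
  rw [hF, pe_bracket 0 S 0 0 0 S hS (by simp) (by simp) hS] at hodd
  rw [hF0, pe_bracket _ 0 0 _ 0 0 (by simp) (by simp) (by simp) (by simp)] at heven
  simp only [zero_mul, mul_zero, add_zero, zero_add, transpose_zero, hSS] at hodd heven
  exact one_ne_zero (hodd.trans heven.symm)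

end Periplectic

/-- Over a field of characteristic 2 (and `k ≥ 3`): the derived superalgebra of `pe(k)`
consists of the matrices `[[A,C],[D,Aᵀ]]` with `C`, `D` symmetric zero-diagonal, its
derived superalgebra additionally satisfies `tr A = 0`, and
`F(X,X') = ∑_{i<j}(C_{ij}D'_{ij} + C'_{ij}D_{ij})` is a 2-cocycle on `pe^{(1)}(k)`
which is not a coboundary, hence defines a nontrivial central extension. -/
theorem periplectic_derived_and_cocycle
    [CharP K 2] (hk : 3 ≤ k) :
    ((derivedSpan K k (peSet K k) : Set (Matrix (Fin k ⊕ Fin k) (Fin k ⊕ Fin k) K))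
        = peSet1 K k) ∧
    ((derivedSpan K k (peSet1 K k) : Set (Matrix (Fin k ⊕ Fin k) (Fin k ⊕ Fin k) K))
        = peSet2 K k) ∧
    (∀ X ∈ peSet1 K k, ∀ Y ∈ peSet1 K k, ∀ Z ∈ peSet1 K k,
      peCocycle K k (X * Y + Y * X) Z + peCocycle K k (Y * Z + Z * Y) X
        + peCocycle K k (Z * X + X * Z) Y = 0) ∧
    ¬ ∃ g : Matrix (Fin k ⊕ Fin k) (Fin k ⊕ Fin k) K →ₗ[K] K,
        ∀ X ∈ peSet1 K k, ∀ Y ∈ peSet1 K k,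
          peCocycle K k X Y = g (X * Y + Y * X) := by
  have i₀ : Fin k := ⟨0, by omega⟩
  exact ⟨Set.Subset.antisymm derivedSpan_peSet_le (peSet1_subset_derivedSpan i₀),
    Set.Subset.antisymm derivedSpan_peSet1_le (peSet2_subset_derivedSpan i₀),
    fun _ hX _ hY _ hZ => peCocycle_cocycle hX hY hZ,
    peCocycle_not_coboundary (i := ⟨0, by omega⟩) (j := ⟨1, by omega⟩) (by simp)⟩
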